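/- Let p : ({-1,1}^n)^d → ℝ be a nonzero block-multilinear polynomial of degree d all of whose nonzero Fourier coefficients are on sets of size exactly D, for some D ∈ [d]. Then MaxInf[p] ≥ (Var[p]/‖p‖_cb)², where MaxInf[p] = max_{b∈[d], i∈[n]} Inf_{b,i}[p]. -/

import Mathlib

noncomputable section

/-- `E m` is the Euclidean space `ℝ^m`. -/
abbrev E (m : ℕ) := EuclideanSpace ℝ (Fin m)

/-- A block-multilinear polynomial `p : ({-1,1}^n)^d → ℝ` is encoded by its Fourier
coefficients `g : (Fin d → Option (Fin n)) → ℝ`: a set `S` of pairs `(block, coordinate)`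
containing at most one pair from each block corresponds to the function `σ` with
`σ b = some i` iff `(b,i) ∈ S`.  `blockSize σ` is the cardinality `|S|`. -/
def blockSize {n d : ℕ} (σ : Fin d → Option (Fin n)) : ℕ :=
  (Finset.univ.filter fun b => (σ b).isSome).card

/-- The evaluation `p(A_1,…,A_d)` of a block-multilinear polynomial on `n`-tuples of
operators: `Σ_S p̂(S) A_{b_1}(i_1)⋯A_{b_s}(i_s)` (with identity in the blocks not
occurring in `S`, giving the ordered product over blocks `b_1 < ⋯ < b_s`). -/
def blockEval {n d m : ℕ} (g : (Fin d → Option (Fin n)) → ℝ)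
    (A : Fin d → Fin n → (E m →L[ℝ] E m)) : E m →L[ℝ] E m :=
  ∑ σ : Fin d → Option (Fin n),
    g σ • (List.ofFn fun b => Option.elim (σ b) 1 fun i => A b i).prod

/-- The completely bounded norm `‖p‖_cb`: the supremum of `‖p(A_1,…,A_d)‖_op` over all
`m` and all tuples of operators of norm at most 1. -/
def cbNorm {n d : ℕ} (g : (Fin d → Option (Fin n)) → ℝ) : ℝ :=
  sSup { r | ∃ (m : ℕ) (A : Fin d → Fin n → (E m →L[ℝ] E m)),
    (∀ b i, ‖A b i‖ ≤ 1) ∧ r = ‖blockEval g A‖ }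

/-- The influence of variable `(b,i)`: `Inf_{b,i}[p] = Σ_{S ∋ (b,i)} p̂(S)²`. -/
def inflB {n d : ℕ} (g : (Fin d → Option (Fin n)) → ℝ) (b : Fin d) (i : Fin n) : ℝ :=
  ∑ σ ∈ Finset.univ.filter (fun σ : Fin d → Option (Fin n) => σ b = some i), g σ ^ 2

/-- The variance `Var[p] = Σ_{S ≠ ∅} p̂(S)²`. -/
def varB {n d : ℕ} (g : (Fin d → Option (Fin n)) → ℝ) : ℝ :=
  ∑ σ ∈ Finset.univ.filter
      (fun σ : Fin d → Option (Fin n) => σ ≠ fun _ => none), g σ ^ 2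

/-- A product of contractions is a contraction. -/
lemma norm_list_prod_le_one {m : ℕ} (l : List (E m →L[ℝ] E m)) (hl : ∀ T ∈ l, ‖T‖ ≤ 1) :
    ‖l.prod‖ ≤ 1 := by
  induction l with
  | nil => simpa using! (ContinuousLinearMap.norm_id_le (𝕜 := ℝ) (E := E m))
  | cons T l ih =>
    rw [List.prod_cons]
    have h1 : ‖T‖ ≤ 1 := hl T (by simp)
    have h2 : ‖l.prod‖ ≤ 1 := ih fun S hS => hl S (by simp [hS])
    calc ‖T * l.prod‖ ≤ ‖T‖ * ‖l.prod‖ := norm_mul_le _ _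
      _ ≤ 1 := mul_le_one₀ h1 (norm_nonneg _) h2

/-- Every value of `‖p(A_1,…,A_d)‖` on contractions is at most `‖p‖_cb`. -/
lemma norm_blockEval_le_cbNorm {n d m : ℕ} (g : (Fin d → Option (Fin n)) → ℝ)
    (A : Fin d → Fin n → (E m →L[ℝ] E m)) (hA : ∀ b i, ‖A b i‖ ≤ 1) :
    ‖blockEval g A‖ ≤ cbNorm g := by
  refine le_csSup ⟨∑ σ, |g σ|, ?_⟩ ⟨m, A, hA, rfl⟩
  rintro r ⟨k, B, hB, rfl⟩
  refine (norm_sum_le _ _).trans (Finset.sum_le_sum fun σ _ => ?_)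
  rw [norm_smul, Real.norm_eq_abs]
  refine mul_le_of_le_one_right (abs_nonneg _) (norm_list_prod_le_one _ fun T hT => ?_)
  obtain ⟨b, rfl⟩ := List.mem_ofFn.1 hT
  cases h : σ b with
  | none => simpa using! (ContinuousLinearMap.norm_id_le (𝕜 := ℝ) (E := E k))
  | some i => simpa using hB b i

/-- Each influence is at most the maximal influence. -/
lemma inflB_le_iSup {n d : ℕ} (g : (Fin d → Option (Fin n)) → ℝ) (b : Fin d) (i : Fin n) :
    inflB g b i ≤ ⨆ (b : Fin d) (i : Fin n), inflB g b i :=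
  (le_ciSup (f := fun i => inflB g b i) (Set.finite_range _).bddAbove i).trans
    (le_ciSup (f := fun b => ⨆ i, inflB g b i) (Set.finite_range _).bddAbove b)

/-- The index set of the Fock-type space: partial monomials, and a final vector `none`. -/
abbrev FockIndex (n d : ℕ) := Option (Fin d → Option (Fin n))

/-- The Fock-type space on which the extremal operators act. -/
abbrev Fock (n d : ℕ) := EuclideanSpace ℝ (FockIndex n d)

/-- The operator that adds the variable `(b, i)` to a partial monomial; when the degree reaches
`D`, the monomial `σ` is sent to `c σ` times the final vector. -/
def creation {n d : ℕ} (c : (Fin d → Option (Fin n)) → ℝ) (D : ℕ) (b : Fin d) (i : Fin n) :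
    Fock n d →ₗ[ℝ] Fock n d where
  toFun x := WithLp.toLp 2 fun t => t.elim
    (∑ σ with σ b = some i, c σ * x (some (Function.update σ b none)))
    fun σ => if σ b = some i ∧ blockSize σ < D then x (some (Function.update σ b none)) else 0
  map_add' x y := by
    ext t
    cases t with
    | none => simp [mul_add, Finset.sum_add_distrib]
    | some σ => by_cases h : σ b = some i ∧ blockSize σ < D <;> simp [h]
  map_smul' r x := by
    ext t
    cases t with
    | none => simp [Finset.mul_sum, mul_left_comm]
    | some σ => by_cases h : σ b = some i ∧ blockSize σ < D <;> simp [h]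

lemma creation_apply_none {n d : ℕ} (c : (Fin d → Option (Fin n)) → ℝ) (D : ℕ) (b : Fin d)
    (i : Fin n) (x : Fock n d) :
    creation c D b i x none =
      ∑ σ with σ b = some i, c σ * x (some (Function.update σ b none)) := rfl

lemma creation_apply_some {n d : ℕ} (c : (Fin d → Option (Fin n)) → ℝ) (D : ℕ) (b : Fin d)
    (i : Fin n) (x : Fock n d) (σ : Fin d → Option (Fin n)) :
    creation c D b i x (some σ) =
      if σ b = some i ∧ blockSize σ < D then x (some (Function.update σ b none)) else 0 := rfl

/-- The operator `creation` is a contraction if the coefficients containing `(b, i)` have square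
sum at most `1`. -/
lemma norm_creation_le {n d : ℕ} (c : (Fin d → Option (Fin n)) → ℝ) (D : ℕ)
    (hc : ∀ σ, c σ ≠ 0 → blockSize σ = D) (b : Fin d) (i : Fin n)
    (hb : ∑ σ with σ b = some i, c σ ^ 2 ≤ 1) (x : Fock n d) :
    ‖creation c D b i x‖ ≤ ‖x‖ := by
  let S := Finset.univ.filter fun σ : Fin d → Option (Fin n) => σ b = some i
  let y : (Fin d → Option (Fin n)) → ℝ := fun σ => x (some (Function.update σ b none))
  have hfinal : (creation c D b i x none) ^ 2 ≤ ∑ σ ∈ S with ¬ blockSize σ < D, y σ ^ 2 := by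
    have hsum : creation c D b i x none = ∑ σ ∈ S with ¬ blockSize σ < D, c σ * y σ := by
      rw [creation_apply_none]
      refine (Finset.sum_filter_of_ne fun σ _ h => ?_).symm
      have := hc σ (left_ne_zero_of_mul h)
      omega
    rw [hsum]
    refine (Finset.sum_mul_sq_le_sq_mul_sq _ _ _).trans ?_
    refine mul_le_of_le_one_left (Finset.sum_nonneg fun _ _ => sq_nonneg _) (le_trans ?_ hb)
    exact Finset.sum_le_sum_of_subset_of_nonneg (Finset.filter_subset _ _)
      fun _ _ _ => sq_nonneg _
  have hpartial : ∑ σ, (creation c D b i x (some σ)) ^ 2 =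
      ∑ σ ∈ S with blockSize σ < D, y σ ^ 2 := by
    rw [Finset.filter_filter, Finset.sum_filter]
    refine Finset.sum_congr rfl fun σ _ => ?_
    rw [creation_apply_some]
    split_ifs <;> simp [y]
  have hinj : Set.InjOn (fun σ : Fin d → Option (Fin n) => Function.update σ b none) S := by
    intro σ hσ τ hτ h
    have hσ' : σ b = some i := by simpa [S] using hσ
    have hτ' : τ b = some i := by simpa [S] using hτ
    funext a
    by_cases ha : a = b
    · rw [ha, hσ', hτ']
    · simpa [ha] using congrFun h a
  have hle : ∑ σ ∈ S, y σ ^ 2 ≤ ∑ σ, x (some σ) ^ 2 := by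
    rw [← Finset.sum_image (f := fun σ => x (some σ) ^ 2) hinj]
    exact Finset.sum_le_sum_of_subset_of_nonneg (Finset.subset_univ _) fun _ _ _ => sq_nonneg _
  have hsplit := Finset.sum_filter_add_sum_filter_not S (fun σ => blockSize σ < D)
    fun σ => y σ ^ 2
  refine le_of_sq_le_sq ?_ (norm_nonneg _)
  rw [EuclideanSpace.real_norm_sq_eq, EuclideanSpace.real_norm_sq_eq, Fintype.sum_option,
    Fintype.sum_option, hpartial]
  nlinarith [sq_nonneg (x none)]

/-- The vector reached from the vacuum by the monomial `σ`. -/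
def monomialVector {n d : ℕ} (c : (Fin d → Option (Fin n)) → ℝ) (D : ℕ)
    (σ : Fin d → Option (Fin n)) : Fock n d :=
  (if blockSize σ < D then EuclideanSpace.single (some σ) 1 else 0) +
    c σ • EuclideanSpace.single none 1

lemma creation_single {n d : ℕ} (c : (Fin d → Option (Fin n)) → ℝ) (D : ℕ) (b : Fin d)
    (i : Fin n) (τ : Fin d → Option (Fin n)) (hτ : τ b = none) :
    creation c D b i (EuclideanSpace.single (some τ) 1) =
      monomialVector c D (Function.update τ b (some i)) := by
  have key : ∀ σ : Fin d → Option (Fin n),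
      (σ b = some i ∧ Function.update σ b none = τ) ↔ σ = Function.update τ b (some i) := by
    intro σ
    constructor
    · rintro ⟨h, rfl⟩
      simp [← h]
    · rintro rfl
      simp [← hτ]
  ext t
  cases t with
  | none =>
    rw [creation_apply_none, Finset.sum_filter,
      Finset.sum_eq_single (Function.update τ b (some i))]
    · have := (key _).2 rfl
      by_cases h : blockSize (Function.update τ b (some i)) < D <;>
        simp [monomialVector, h, this.2]
    · intro σ _ hσ
      have := mt (key σ).1 hσ
      by_cases h : σ b = some i
      · have h' : Function.update σ b none ≠ τ := fun h' => this ⟨h, h'⟩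
        simp [h, h']
      · simp [h]
    · simp
  | some σ =>
    rw [creation_apply_some]
    by_cases hσ : σ = Function.update τ b (some i)
    · have := (key σ).2 hσ
      rw [this.2, ← hσ]
      by_cases h : blockSize σ < D <;> simp [monomialVector, h, this.1]
    · have h0 := mt (key σ).1 hσ
      have : (monomialVector c D (Function.update τ b (some i))) (some σ) = 0 := by
        by_cases h : blockSize (Function.update τ b (some i)) < D <;>
          simp [monomialVector, h, hσ]
      rw [this]
      split_ifs with h
      · have h' : Function.update σ b none ≠ τ := fun h' => h0 ⟨h.1, h'⟩
        simp [h']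
      · rfl

/-- The restriction of the monomial `σ` to the blocks in the list `l`. -/
def restrictBlocks {n d : ℕ} (σ : Fin d → Option (Fin n)) (l : List (Fin d)) :
    Fin d → Option (Fin n) :=
  fun b => if b ∈ l then σ b else none

lemma blockSize_restrictBlocks_lt {n d : ℕ} (σ : Fin d → Option (Fin n)) (l : List (Fin d))
    (b : Fin d) (hb : b ∉ l) (hσ : (σ b).isSome) :
    blockSize (restrictBlocks σ l) < blockSize σ := by
  refine Finset.card_lt_card (Finset.ssubset_iff_of_subset ?_ |>.2 ⟨b, ?_, ?_⟩)
  · intro a ha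
    have ha' := (Finset.mem_filter.1 ha).2
    refine Finset.mem_filter.2 ⟨Finset.mem_univ _, ?_⟩
    by_cases h : a ∈ l
    · simpa [restrictBlocks, h] using ha'
    · simp [restrictBlocks, h] at ha'
  · exact Finset.mem_filter.2 ⟨Finset.mem_univ _, hσ⟩
  · intro h
    simpa [restrictBlocks, hb] using (Finset.mem_filter.1 h).2

/-- Applying in order the operators of a monomial `σ` of size `D` to the vacuum. -/
lemma prod_apply_vacuum {n d m D : ℕ} (c : (Fin d → Option (Fin n)) → ℝ)
    (hc : ∀ σ, c σ ≠ 0 → blockSize σ = D) (hD : 1 ≤ D) (U : Fock n d →ₗ[ℝ] E m)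
    (A : Fin d → Fin n → (E m →L[ℝ] E m)) (hA : ∀ b i x, A b i (U x) = U (creation c D b i x))
    (σ : Fin d → Option (Fin n)) (hσ : blockSize σ = D) (l : List (Fin d)) (hl : l.Nodup) :
    (l.map fun b => Option.elim (σ b) 1 fun i => A b i).prod
        (U (EuclideanSpace.single (some fun _ => none) 1)) =
      U (monomialVector c D (restrictBlocks σ l)) := by
  induction l with
  | nil =>
    have h0 : blockSize (fun _ : Fin d => (none : Option (Fin n))) = 0 := by simp [blockSize]
    have hc0 : c (fun _ => none) = 0 := by
      by_contra h
      have := hc _ h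
      omega
    have h1 : restrictBlocks σ [] = fun _ => none := by ext; simp [restrictBlocks]
    have h2 : 0 < D := hD
    simp [h1, monomialVector, h0, hc0, h2]
  | cons b l ih =>
    obtain ⟨hb, hl⟩ := List.nodup_cons.1 hl
    rw [List.map_cons, List.prod_cons, mul_apply_eq_comp, ih hl]
    cases h : σ b with
    | none =>
      have : restrictBlocks σ (b :: l) = restrictBlocks σ l := by
        funext a
        by_cases ha : a = b
        · subst ha; simp [restrictBlocks, h]
        · simp [restrictBlocks, ha]
      simp [this]
    | some i =>
      have hlt := blockSize_restrictBlocks_lt σ l b hb (by simp [h])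
      have hc0 : c (restrictBlocks σ l) = 0 := by
        by_contra h'
        have := hc _ h'
        omega
      have hv : monomialVector c D (restrictBlocks σ l) =
          EuclideanSpace.single (some (restrictBlocks σ l)) 1 := by
        simp [monomialVector, hc0, ← hσ, hlt]
      have hu : restrictBlocks σ (b :: l) =
          Function.update (restrictBlocks σ l) b (some i) := by
        funext a
        by_cases ha : a = b
        · subst ha; simp [restrictBlocks, h]
        · simp [restrictBlocks, ha]
      rw [hv, Option.elim_some, hA, creation_single _ _ _ _ _ (by simp [restrictBlocks, hb]), hu]

/-- If `p` is homogeneous of degree `D ≥ 1` and `c` is a normalised functional of degree `D`, then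
the pairing of `p` with `c` is at most `‖p‖_cb`. -/
lemma sum_mul_le_cbNorm {n d D : ℕ} (g c : (Fin d → Option (Fin n)) → ℝ)
    (hg : ∀ σ, g σ ≠ 0 → blockSize σ = D) (hc : ∀ σ, c σ ≠ 0 → blockSize σ = D) (hD : 1 ≤ D)
    (hb : ∀ b i, ∑ σ with σ b = some i, c σ ^ 2 ≤ 1) :
    ∑ σ, g σ * c σ ≤ cbNorm g := by
  let U : Fock n d ≃ₗᵢ[ℝ] E (Fintype.card (FockIndex n d)) :=
    LinearIsometryEquiv.piLpCongrLeft 2 ℝ ℝ (Fintype.equivFin (FockIndex n d))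
  let A : Fin d → Fin n → (E (Fintype.card (FockIndex n d)) →L[ℝ] E _) := fun b i =>
    LinearMap.toContinuousLinearMap
      (U.toLinearEquiv.toLinearMap ∘ₗ creation c D b i ∘ₗ U.symm.toLinearEquiv.toLinearMap)
  have hA : ∀ b i x, A b i (U x) = U (creation c D b i x) := fun b i x => by simp [A]
  have hA1 : ∀ b i, ‖A b i‖ ≤ 1 := fun b i => by
    refine ContinuousLinearMap.opNorm_le_bound _ zero_le_one fun x => ?_
    obtain ⟨x, rfl⟩ := U.surjective x
    rw [hA, one_mul, U.norm_map, U.norm_map]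
    exact norm_creation_le c D hc b i (hb b i) x
  have heval : blockEval g A (U (EuclideanSpace.single (some fun _ => none) 1)) =
      (∑ σ, g σ * c σ) • U (EuclideanSpace.single none 1) := by
    rw [blockEval, sum_apply, Finset.sum_smul]
    refine Finset.sum_congr rfl fun σ _ => ?_
    by_cases h : g σ = 0
    · simp [h]
    have hσ := hg σ h
    have hprod := prod_apply_vacuum c hc hD U.toLinearEquiv.toLinearMap A hA σ hσ
      (List.finRange d) (List.nodup_finRange d)
    have hr : restrictBlocks σ (List.finRange d) = σ := by funext; simp [restrictBlocks]
    rw [hr, ← List.ofFn_eq_map] at hprod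
    rw [smul_apply]
    refine (congrArg (g σ • ·) hprod).trans ?_
    simp [monomialVector, hσ, mul_smul]
  have h1 := (blockEval g A).le_opNorm (U (EuclideanSpace.single (some fun _ => none) 1))
  rw [heval, norm_smul, U.norm_map, U.norm_map] at h1
  simp only [PiLp.norm_single, norm_one, mul_one] at h1
  exact (le_abs_self _).trans (h1.trans (norm_blockEval_le_cbNorm g A hA1))

/-- A nonzero block-multilinear polynomial of degree `d` whose nonzero
Fourier coefficients are all on sets of size exactly `D ∈ [d]` satisfies
`MaxInf[p] ≥ (Var[p]/‖p‖_cb)²`. -/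
theorem stmt_8 {n d : ℕ} (g : (Fin d → Option (Fin n)) → ℝ) (hne : g ≠ 0)
    (D : ℕ) (hD1 : 1 ≤ D) (hD2 : D ≤ d)
    (hsupp : ∀ σ : Fin d → Option (Fin n), g σ ≠ 0 → blockSize σ = D) :
    (varB g / cbNorm g) ^ 2 ≤ ⨆ (b : Fin d) (i : Fin n), inflB g b i := by
  set M := ⨆ (b : Fin d) (i : Fin n), inflB g b i with hM
  have hle : ∀ b i, inflB g b i ≤ M := inflB_le_iSup g
  have hg0 : g (fun _ => none) = 0 := by
    by_contra h
    have := hsupp _ h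
    simp [blockSize] at this
    omega
  have hvar : varB g = ∑ σ, g σ ^ 2 := by
    refine Finset.sum_filter_of_ne fun σ _ h hσ => h ?_
    simp [hσ, hg0]
  obtain ⟨σ, hσ⟩ := Function.ne_iff.1 hne
  have hvar_pos : 0 < varB g := by
    rw [hvar]
    exact Finset.sum_pos' (fun _ _ => sq_nonneg _) ⟨σ, Finset.mem_univ _, sq_pos_of_ne_zero hσ⟩
  have hM_pos : 0 < M := by
    have hcard : 0 < blockSize σ := by rw [hsupp σ hσ]; omega
    obtain ⟨b, hb⟩ := Finset.card_pos.1 hcard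
    obtain ⟨i, hi⟩ := Option.isSome_iff_exists.1 (Finset.mem_filter.1 hb).2
    refine lt_of_lt_of_le ?_ (hle b i)
    exact Finset.sum_pos' (fun _ _ => sq_nonneg _) ⟨σ, by simp [hi], sq_pos_of_ne_zero hσ⟩
  have hsq : 0 < √M := Real.sqrt_pos.2 hM_pos
  have hmain : ∑ σ, g σ * (g σ / √M) ≤ cbNorm g := by
    refine sum_mul_le_cbNorm g (fun σ => g σ / √M) hsupp
      (fun σ h => hsupp σ fun h0 => h (by simp [h0])) hD1 fun b i => ?_
    simp only [div_pow, Real.sq_sqrt hM_pos.le]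
    rw [← Finset.sum_div, div_le_one hM_pos]
    exact hle b i
  have heq : ∑ σ, g σ * (g σ / √M) = varB g / √M := by
    rw [hvar, Finset.sum_div]
    exact Finset.sum_congr rfl fun _ _ => by ring
  rw [heq, div_le_iff₀ hsq] at hmain
  have hcb : 0 < cbNorm g := pos_of_mul_pos_left (hvar_pos.trans_le hmain) hsq.le
  rw [← Real.sq_sqrt hM_pos.le]
  gcongr
  rw [div_le_iff₀ hcb]
  linarith
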